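/- arXiv:1511.07877 — 3 statements merged into one kernel-verified Lean document; each statement's English description precedes it below -/
import Mathlib

section
/- Let G = (V,E) be a connected graph, let A, B ⊆ V be disjoint, and let A' be a co-connected closure of A. Then: (a) ∂•A' ⊆ ∂•A, ∂◦A' ⊆ ∂◦A and ∂A' ⊆ ∂A; (b) ∂•(B \ A') ⊆ ∂•B; (c) if B is co-connected then B \ A' is also co-connected; (d) if B is connected then either B ⊆ A' or B ∩ A' = ∅. -/
open scoped Classical

namespace AF3Potts

variable {Vt : Type*}

/-- `N(U)`: vertices adjacent to some vertex of `U`. -/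
def nbrG (G : SimpleGraph Vt) (U : Set Vt) : Set Vt := {v | ∃ u ∈ U, G.Adj u v}

/-- External boundary `∂◦U`. -/
def extBG (G : SimpleGraph Vt) (U : Set Vt) : Set Vt := nbrG G U \ U

/-- Internal boundary `∂•U := ∂◦(Uᶜ)`. -/
def intBG (G : SimpleGraph Vt) (U : Set Vt) : Set Vt := extBG G Uᶜ

/-- Edge boundary `∂U`: edges with exactly one endpoint in `U`. -/
def edgeBG (G : SimpleGraph Vt) (U : Set Vt) : Set (Sym2 Vt) :=
  {e | e ∈ G.edgeSet ∧ ∃ u v, e = s(u, v) ∧ u ∈ U ∧ v ∉ U}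

/-- The connected component of `v` inside the set `S` (empty if `v ∉ S`). -/
def connInG (G : SimpleGraph Vt) (S : Set Vt) (v : Vt) : Set Vt :=
  {u | ∃ hu : u ∈ S, ∃ hv : v ∈ S, (G.induce S).Reachable ⟨u, hu⟩ ⟨v, hv⟩}

/-- The co-connected closure of `U` with respect to `v`: the complement of the
connected component of `Vᶜ \ U` containing `v` (all of `V` when `v ∈ U`). -/
def coClosureG (G : SimpleGraph Vt) (U : Set Vt) (v : Vt) : Set Vt :=
  (connInG G Uᶜ v)ᶜ

theorem connInG_subset (G : SimpleGraph Vt) (S : Set Vt) (v : Vt) : connInG G S v ⊆ S :=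
  fun _ h => h.1

theorem mem_connInG_of_adj {G : SimpleGraph Vt} {S : Set Vt} {v u w : Vt}
    (hu : u ∈ connInG G S v) (huw : G.Adj u w) (hw : w ∈ S) : w ∈ connInG G S v := by
  obtain ⟨huS, hv, h⟩ := hu
  have hadj : (G.induce S).Adj ⟨w, hw⟩ ⟨u, huS⟩ := huw.symm
  exact ⟨hw, hv, hadj.reachable.trans h⟩

theorem mem_of_adj_connInG_compl {G : SimpleGraph Vt} {A : Set Vt} {v u w : Vt}
    (hu : u ∈ connInG G Aᶜ v) (huw : G.Adj u w) (hw : w ∉ connInG G Aᶜ v) : w ∈ A := by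
  by_contra h
  exact hw (mem_connInG_of_adj hu huw h)

theorem subset_connInG_of_preconnected {G : SimpleGraph Vt} {S B : Set Vt} {v b : Vt}
    (hB : (G.induce B).Preconnected) (hBS : B ⊆ S) (hb : b ∈ B) (hbv : b ∈ connInG G S v) :
    B ⊆ connInG G S v := by
  intro x hx
  obtain ⟨_, hv, h⟩ := hbv
  exact ⟨hBS hx, hv, ((hB ⟨x, hx⟩ ⟨b, hb⟩).map (G.induceHomOfLE hBS).toHom).trans h⟩

/-- If no edge joins `B ∩ C` to `B \ C`, then a walk starting outside `B ∩ C` and ending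
outside `B` contains a path avoiding `B ∩ C` from its start to `Bᶜ`. -/
theorem exists_reachable_compl_of_walk {G : SimpleGraph Vt} {B C : Set Vt}
    (hBC : ∀ ⦃x y⦄, x ∈ B → y ∈ B → G.Adj x y → y ∈ C → x ∈ C) {x y : Vt} (p : G.Walk x y)
    (hy : y ∉ B) (hx : x ∈ (B ∩ C)ᶜ) :
    ∃ z, ∃ hz : z ∈ Bᶜ, (G.induce (B ∩ C)ᶜ).Reachable ⟨x, hx⟩ ⟨z, fun h => hz h.1⟩ := by
  induction p with
  | nil => exact ⟨_, hy, .rfl⟩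
  | @cons x w _ hxw _ ih =>
    by_cases hxB : x ∈ B
    · have hw : w ∈ (B ∩ C)ᶜ := fun h => hx ⟨hxB, hBC hxB h.1 hxw h.2⟩
      obtain ⟨z, hz, h⟩ := ih hy hw
      have hadj : (G.induce (B ∩ C)ᶜ).Adj ⟨x, hx⟩ ⟨w, hw⟩ := hxw
      exact ⟨z, hz, hadj.reachable.trans h⟩
    · exact ⟨x, hxB, .rfl⟩

theorem connected_induce_compl_inter {G : SimpleGraph Vt} (hG : G.Connected) {B C : Set Vt}
    (hBC : ∀ ⦃x y⦄, x ∈ B → y ∈ B → G.Adj x y → y ∈ C → x ∈ C)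
    (hB : (G.induce Bᶜ).Connected) : (G.induce (B ∩ C)ᶜ).Connected := by
  obtain ⟨b, hb⟩ := hB.nonempty
  have hsub : Bᶜ ⊆ (B ∩ C)ᶜ := fun z hz h => hz h.1
  refine SimpleGraph.connected_iff_exists_forall_reachable _ |>.2 ⟨⟨b, hsub hb⟩, ?_⟩
  rintro ⟨x, hx⟩
  obtain ⟨p⟩ := hG.preconnected x b
  obtain ⟨z, hz, h⟩ := exists_reachable_compl_of_walk hBC p hb hx
  exact (h.trans ((hB.preconnected ⟨z, hz⟩ ⟨b, hb⟩).map (G.induceHomOfLE hsub).toHom)).symm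

/-- Lemma 2.5. Properties of co-connected closures in a
connected graph: let `A, B` be disjoint and `A'` a co-connected closure of `A`.
Then (a) the boundaries of `A'` are contained in those of `A`; (b)
`∂•(B \ A') ⊆ ∂•B`; (c) if `B` is co-connected then so is `B \ A'`;
(d) a connected `B` is contained in `A'` or disjoint from it. -/
theorem statement6 (G : SimpleGraph Vt) (hG : G.Connected) (A B : Set Vt)
    (hAB : Disjoint A B) (v : Vt) :
    (intBG G (coClosureG G A v) ⊆ intBG G A ∧
      extBG G (coClosureG G A v) ⊆ extBG G A ∧
      edgeBG G (coClosureG G A v) ⊆ edgeBG G A) ∧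
    intBG G (B \ coClosureG G A v) ⊆ intBG G B ∧
    ((G.induce Bᶜ).Connected → (G.induce (B \ coClosureG G A v)ᶜ).Connected) ∧
    ((G.induce B).Connected →
      B ⊆ coClosureG G A v ∨ B ∩ coClosureG G A v = ∅) := by
  have hBA : B ⊆ Aᶜ := fun x hx hxA => hAB.notMem_of_mem_left hxA hx
  have hdiff : B \ coClosureG G A v = B ∩ connInG G Aᶜ v := by
    rw [coClosureG, sdiff_compl]; rfl
  have hBC : ∀ ⦃x y⦄, x ∈ B → y ∈ B → G.Adj x y → y ∈ connInG G Aᶜ v → x ∈ connInG G Aᶜ v :=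
    fun x y hx _ hxy hyC => mem_connInG_of_adj hyC hxy.symm (hBA hx)
  refine ⟨⟨?_, ?_, ?_⟩, ?_, ?_, ?_⟩
  · rintro x ⟨⟨u, hu, hux⟩, hx⟩
    have huC : u ∈ connInG G Aᶜ v := not_not.1 hu
    have hxC : x ∉ connInG G Aᶜ v := not_not.1 hx
    exact ⟨⟨u, connInG_subset G _ v huC, hux⟩,
      not_not.2 (mem_of_adj_connInG_compl huC hux hxC)⟩
  · rintro x ⟨⟨u, hu, hux⟩, hx⟩
    have hxC : x ∈ connInG G Aᶜ v := not_not.1 hx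
    exact ⟨⟨u, mem_of_adj_connInG_compl hxC hux.symm hu, hux⟩, connInG_subset G _ v hxC⟩
  · rintro _ ⟨he, u, w, rfl, hu, hw⟩
    have hwC : w ∈ connInG G Aᶜ v := not_not.1 hw
    have huw : G.Adj u w := he
    exact ⟨he, u, w, rfl, mem_of_adj_connInG_compl hwC huw.symm hu, connInG_subset G _ v hwC⟩
  · rw [hdiff]
    rintro x ⟨⟨u, hu, hux⟩, hx⟩
    obtain ⟨hxB, hxC⟩ := not_not.1 hx
    exact ⟨⟨u, fun huB => hu ⟨huB, hBC huB hxB hux hxC⟩, hux⟩, not_not.2 hxB⟩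
  · rw [hdiff]
    exact connected_induce_compl_inter hG hBC
  · intro hB
    by_cases h : ∃ b ∈ B, b ∈ connInG G Aᶜ v
    · obtain ⟨b, hb, hbC⟩ := h
      refine .inr (Set.eq_empty_of_forall_notMem fun x hx => ?_)
      exact hx.2 (subset_connInG_of_preconnected hB.preconnected hBA hb hbC hx.1)
    · exact .inl fun x hx hxC => h ⟨x, hx, hxC⟩

end AF3Potts
end

section
/- Let W be a finite bipartite graph with bipartition classes W_• and W_◦, and let 0 ≤ p ≤ 1. Then Σ_{(V_•,V_◦) ∈ MC(W_•,W_◦)} p^{|V_•|}·(1−p)^{|V_◦|} ≤ 1, where MC(W_•,W_◦) is the set of minimal covers of (W_•,W_◦). -/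
open scoped Classical

namespace AF3Potts

variable {Vt : Type*}

/-- A vertex-cover of a graph: a set of vertices meeting every edge. -/
def IsVertexCover (G : SimpleGraph Vt) (U : Set Vt) : Prop :=
  ∀ u v, G.Adj u v → u ∈ U ∨ v ∈ U

/-- A minimal vertex-cover: minimal with respect to inclusion. -/
def IsMinVertexCover (G : SimpleGraph Vt) (U : Set Vt) : Prop :=
  IsVertexCover G U ∧ ∀ U' ⊆ U, IsVertexCover G U' → U' = U

/-- `(P, Q)` is a cover of the edges of the relation `r` between `B` and `C` in which every member
has a private neighbour. -/
def IsIrredundantCover {α β : Type*} (r : α → β → Prop) (B : Finset α) (C : Finset β)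
    (P : Finset α) (Q : Finset β) : Prop :=
  P ⊆ B ∧ Q ⊆ C ∧ (∀ b ∈ B, ∀ c ∈ C, r b c → b ∈ P ∨ c ∈ Q) ∧
    (∀ b ∈ P, ∃ c ∈ C, c ∉ Q ∧ r b c) ∧ ∀ c ∈ Q, ∃ b ∈ B, b ∉ P ∧ r b c

/-- The finset of irredundant covers of the relation `r` between `B` and `C`. -/
noncomputable def irredundantCovers {α β : Type*} (r : α → β → Prop) (B : Finset α)
    (C : Finset β) : Finset (Finset α × Finset β) :=
  (B.powerset ×ˢ C.powerset).filter fun P => IsIrredundantCover r B C P.1 P.2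

theorem mem_irredundantCovers {α β : Type*} {r : α → β → Prop} {B : Finset α} {C : Finset β}
    {P : Finset α × Finset β} :
    P ∈ irredundantCovers r B C ↔ IsIrredundantCover r B C P.1 P.2 := by
  simp only [irredundantCovers, Finset.mem_filter, Finset.mem_product, Finset.mem_powerset,
    and_iff_right_iff_imp]
  exact fun h => ⟨h.1, h.2.1⟩

namespace IsIrredundantCover

variable {α β : Type*} {r : α → β → Prop} {v : α} {B P : Finset α} {C Q : Finset β}

theorem of_isolated (hN : C.filter (r v) = ∅) (h : IsIrredundantCover r (insert v B) C P Q) :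
    IsIrredundantCover r B C P Q := by
  have hv : ∀ c ∈ C, ¬ r v c := by simpa [Finset.filter_eq_empty_iff] using hN
  obtain ⟨h1, h2, h3, h4, h5⟩ := h
  refine ⟨fun x hx => ?_, h2, by grind, h4, by grind⟩
  have := h1 hx
  have := h4 x hx
  grind

theorem erase_of_mem (hvB : v ∉ B) (hvP : v ∈ P)
    (h : IsIrredundantCover r (insert v B) C P Q) :
    IsIrredundantCover r B C (P.erase v) Q := by
  obtain ⟨h1, h2, h3, h4, h5⟩ := h
  exact ⟨by grind, h2, by grind, by grind, by grind⟩

theorem filter_subset_of_notMem (hvP : v ∉ P) (h : IsIrredundantCover r (insert v B) C P Q) :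
    C.filter (r v) ⊆ Q := by
  obtain ⟨h1, h2, h3, h4, h5⟩ := h
  grind

theorem sdiff_of_notMem (hvP : v ∉ P) (h : IsIrredundantCover r (insert v B) C P Q) :
    IsIrredundantCover r B (C \ C.filter (r v)) P (Q \ C.filter (r v)) := by
  have hNQ := h.filter_subset_of_notMem hvP
  obtain ⟨h1, h2, h3, h4, h5⟩ := h
  exact ⟨by grind, by grind, by grind, by grind, by grind⟩

end IsIrredundantCover

theorem sum_irredundantCovers_le_one {α β : Type*} (r : α → β → Prop) {p : ℝ} (hp0 : 0 ≤ p)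
    (hp1 : p ≤ 1) (B : Finset α) (C : Finset β) :
    ∑ P ∈ irredundantCovers r B C, p ^ P.1.card * (1 - p) ^ P.2.card ≤ 1 := by
  have hq0 : 0 ≤ 1 - p := by linarith
  have hnonneg : ∀ P : Finset α × Finset β, 0 ≤ p ^ P.1.card * (1 - p) ^ P.2.card :=
    fun P => by positivity
  induction B using Finset.induction_on generalizing C with
  | empty =>
    have hsub : irredundantCovers r ∅ C ⊆ {(∅, ∅)} := by
      rintro ⟨P, Q⟩ h
      obtain ⟨h1, -, -, -, h5⟩ := mem_irredundantCovers.1 h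
      have hP : P = ∅ := Finset.subset_empty.1 h1
      have hQ : Q = ∅ := Finset.eq_empty_of_forall_notMem fun c hc => by
        simpa using h5 c hc
      simp [hP, hQ]
    exact (Finset.sum_le_sum_of_subset_of_nonneg hsub fun P _ _ => hnonneg P).trans (by simp)
  | insert v B hvB ih =>
    set N := C.filter (r v)
    by_cases hN : N = ∅
    · refine (Finset.sum_le_sum_of_subset_of_nonneg (fun P hP => ?_)
        fun P _ _ => hnonneg P).trans (ih C)
      exact mem_irredundantCovers.2 ((mem_irredundantCovers.1 hP).of_isolated hN)
    have hsub : irredundantCovers r (insert v B) C ⊆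
        (irredundantCovers r B C).image (fun P => (insert v P.1, P.2)) ∪
        (irredundantCovers r B (C \ N)).image (fun P => (P.1, P.2 ∪ N)) := by
      rintro ⟨P, Q⟩ h
      have h' := mem_irredundantCovers.1 h
      by_cases hvP : v ∈ P
      · refine Finset.mem_union_left _ (Finset.mem_image.2 ⟨(P.erase v, Q), ?_, ?_⟩)
        · exact mem_irredundantCovers.2 (h'.erase_of_mem hvB hvP)
        · simp [Finset.insert_erase hvP]
      · refine Finset.mem_union_right _ (Finset.mem_image.2 ⟨(P, Q \ N), ?_, ?_⟩)
        · exact mem_irredundantCovers.2 (h'.sdiff_of_notMem hvP)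
        · simp [Finset.sdiff_union_of_subset (h'.filter_subset_of_notMem hvP), N]
    have hmem : ∑ P ∈ (irredundantCovers r B C).image (fun P => (insert v P.1, P.2)),
        p ^ P.1.card * (1 - p) ^ P.2.card ≤ p := by
      have hnot : ∀ P ∈ irredundantCovers r B C, v ∉ P.1 := fun P hP hv =>
        hvB ((mem_irredundantCovers.1 hP).1 hv)
      rw [Finset.sum_image]
      · calc _ = p * ∑ P ∈ irredundantCovers r B C, p ^ P.1.card * (1 - p) ^ P.2.card := by
              rw [Finset.mul_sum]
              refine Finset.sum_congr rfl fun P hP => ?_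
              rw [Finset.card_insert_of_notMem (hnot P hP)]
              ring
          _ ≤ p := mul_le_of_le_one_right hp0 (ih C)
      · rintro ⟨P, Q⟩ hP ⟨P', Q'⟩ hP' heq
        have h1 := hnot _ hP
        have h2 := hnot _ hP'
        simp only [Prod.mk.injEq] at heq h1 h2 ⊢
        exact ⟨by rw [← Finset.erase_insert h1, heq.1, Finset.erase_insert h2], heq.2⟩
    have hnotMem : ∑ P ∈ (irredundantCovers r B (C \ N)).image (fun P => (P.1, P.2 ∪ N)),
        p ^ P.1.card * (1 - p) ^ P.2.card ≤ 1 - p := by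
      have hdisj : ∀ P ∈ irredundantCovers r B (C \ N), Disjoint P.2 N := fun P hP =>
        Finset.disjoint_of_subset_left (mem_irredundantCovers.1 hP).2.1 Finset.sdiff_disjoint
      rw [Finset.sum_image]
      · calc _ = (1 - p) ^ N.card * ∑ P ∈ irredundantCovers r B (C \ N),
                p ^ P.1.card * (1 - p) ^ P.2.card := by
              rw [Finset.mul_sum]
              refine Finset.sum_congr rfl fun P hP => ?_
              rw [Finset.card_union_of_disjoint (hdisj P hP)]
              ring
          _ ≤ (1 - p) ^ N.card := mul_le_of_le_one_right (by positivity) (ih _)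
          _ ≤ 1 - p := pow_le_of_le_one hq0 (by linarith) (Finset.card_ne_zero.2
              (Finset.nonempty_iff_ne_empty.2 hN))
      · rintro ⟨P, Q⟩ hP ⟨P', Q'⟩ hP' heq
        have h1 := hdisj _ hP
        have h2 := hdisj _ hP'
        simp only [Prod.mk.injEq] at heq h1 h2 ⊢
        exact ⟨heq.1, by rw [← Finset.union_sdiff_cancel_right h1, heq.2,
          Finset.union_sdiff_cancel_right h2]⟩
    refine (Finset.sum_le_sum_of_subset_of_nonneg hsub fun P _ _ => hnonneg P).trans ?_
    refine (le_add_of_nonneg_right (Finset.sum_nonneg fun P _ => hnonneg P)).trans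
      (Finset.sum_union_inter.trans_le ?_)
    linarith

/-- Every vertex of a minimal vertex-cover has a neighbour outside the cover. -/
theorem IsMinVertexCover.exists_adj_notMem {G : SimpleGraph Vt} {U : Set Vt}
    (h : IsMinVertexCover G U) {b : Vt} (hb : b ∈ U) : ∃ c, c ∉ U ∧ G.Adj b c := by
  by_contra! hc
  have hcov : IsVertexCover G (U \ {b}) := by
    intro u v huv
    have h1 := h.1 u v huv
    have h2 := huv.symm
    have h3 := huv.ne
    have h4 := hc u
    have h5 := hc v
    simp only [Set.mem_sdiff, Set.mem_singleton_iff]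
    grind
  have heq := h.2 _ Set.sdiff_subset hcov
  rw [← heq] at hb
  exact hb.2 rfl

theorem IsMinVertexCover.isIrredundantCover {G : SimpleGraph Vt} {Wb Wc P Q : Finset Vt}
    (hdisj : Disjoint Wb Wc)
    (hbip : ∀ u v, G.Adj u v → (u ∈ Wb ∧ v ∈ Wc) ∨ (u ∈ Wc ∧ v ∈ Wb))
    (hP : P ⊆ Wb) (hQ : Q ⊆ Wc) (h : IsMinVertexCover G ((P : Set Vt) ∪ (Q : Set Vt))) :
    IsIrredundantCover G.Adj Wb Wc P Q := by
  have hd : ∀ x ∈ Wb, x ∉ Wc := fun x hx hx' => Finset.disjoint_left.1 hdisj hx hx'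
  refine ⟨hP, hQ, fun b hb c hc hbc => ?_, fun b hb => ?_, fun c hc => ?_⟩
  · have := h.1 b c hbc
    simp only [Set.mem_union, Finset.mem_coe] at this
    grind
  · obtain ⟨c, hc, hbc⟩ := h.exists_adj_notMem (b := b) (by simp [hb])
    simp only [Set.mem_union, Finset.mem_coe, not_or] at hc
    have := hbip b c hbc
    exact ⟨c, by grind, hc.2, hbc⟩
  · obtain ⟨b, hb, hcb⟩ := h.exists_adj_notMem (b := c) (by simp [hc])
    simp only [Set.mem_union, Finset.mem_coe, not_or] at hb
    have := hbip c b hcb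
    exact ⟨b, by grind, hb.1, hcb.symm⟩

/-- Lemma 4.9. Let `W` be a finite bipartite graph with
bipartition classes `W_•`, `W_◦` and `0 ≤ p ≤ 1`. Then the sum over all minimal
covers `(V_•,V_◦)` of `(W_•,W_◦)` of `p^{|V_•|}·(1−p)^{|V_◦|}` is at most 1. -/
theorem statement14 [Fintype Vt] (G : SimpleGraph Vt) (Wb Wc : Finset Vt)
    (hdisj : Disjoint Wb Wc) (hcover : Wb ∪ Wc = Finset.univ)
    (hbip : ∀ u v, G.Adj u v → (u ∈ Wb ∧ v ∈ Wc) ∨ (u ∈ Wc ∧ v ∈ Wb))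
    (p : ℝ) (hp0 : 0 ≤ p) (hp1 : p ≤ 1) :
    ∑ P ∈ (Finset.univ : Finset (Finset Vt × Finset Vt)).filter
        (fun P => P.1 ⊆ Wb ∧ P.2 ⊆ Wc ∧
          IsMinVertexCover G ((P.1 : Set Vt) ∪ (P.2 : Set Vt))),
      p ^ P.1.card * (1 - p) ^ P.2.card ≤ 1 := by
  refine (Finset.sum_le_sum_of_subset_of_nonneg (fun P hP => ?_) fun P _ _ => ?_).trans
    (sum_irredundantCovers_le_one G.Adj hp0 hp1 Wb Wc)
  · obtain ⟨-, h1, h2, h3⟩ := Finset.mem_filter.1 hP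
    exact mem_irredundantCovers.2 (h3.isIrredundantCover hdisj hbip h1 h2)
  · have : 0 ≤ 1 - p := by linarith
    positivity

end AF3Potts
end

section
/- Let G = (V,E) be a finite graph and let (p_v)_{v ∈ V} be nonnegative real numbers such that p_u + p_v ≤ 1 for every edge {u,v} ∈ E. Then Σ_{U ∈ MC(G)} ∏_{u ∈ U} p_u ≤ 1, where MC(G) is the set of minimal vertex-covers of G. -/
open scoped Classical

namespace AF3Potts

variable {Vt : Type*}

/-- `U` is a minimal vertex-cover of the subgraph induced on `S`, expressed by private neighbours. -/
def IsMinCoverOn (G : SimpleGraph Vt) (S U : Finset Vt) : Prop :=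
  U ⊆ S ∧ (∀ u ∈ S, ∀ v ∈ S, G.Adj u v → u ∈ U ∨ v ∈ U) ∧
    ∀ u ∈ U, ∃ w ∈ S, w ∉ U ∧ G.Adj u w

/-- The weighted count of the minimal vertex-covers of the subgraph induced on `S`. -/
noncomputable def minCoverSum (G : SimpleGraph Vt) (p : Vt → ℝ) (S : Finset Vt) : ℝ :=
  ∑ U ∈ S.powerset.filter (IsMinCoverOn G S), ∏ u ∈ U, p u

lemma sum_prod_le_prod_mul_minCoverSum (G : SimpleGraph Vt) (p : Vt → ℝ) (hp : ∀ v, 0 ≤ p v)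
    (F : Finset (Finset Vt)) (A T : Finset Vt)
    (hF : ∀ U ∈ F, A ⊆ U ∧ IsMinCoverOn G T (U \ A)) :
    ∑ U ∈ F, ∏ u ∈ U, p u ≤ (∏ u ∈ A, p u) * minCoverSum G p T := by
  have hinj : Set.InjOn (fun U => U \ A) (F : Set (Finset Vt)) := by
    intro U hU U' hU' h
    rw [← Finset.sdiff_union_of_subset (hF U hU).1, ← Finset.sdiff_union_of_subset (hF U' hU').1]
    exact congrArg (· ∪ A) h
  have hsub : F.image (fun U => U \ A) ⊆ T.powerset.filter (IsMinCoverOn G T) := by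
    intro W hW
    obtain ⟨U, hU, rfl⟩ := Finset.mem_image.1 hW
    exact Finset.mem_filter.2 ⟨Finset.mem_powerset.2 (hF U hU).2.1, (hF U hU).2⟩
  calc ∑ U ∈ F, ∏ u ∈ U, p u = ∑ U ∈ F, (∏ u ∈ A, p u) * ∏ u ∈ U \ A, p u := by
        refine Finset.sum_congr rfl fun U hU => ?_
        rw [mul_comm, Finset.prod_sdiff (hF U hU).1]
    _ = (∏ u ∈ A, p u) * ∑ W ∈ F.image (fun U => U \ A), ∏ u ∈ W, p u := by
        rw [Finset.sum_image hinj, Finset.mul_sum]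
    _ ≤ (∏ u ∈ A, p u) * minCoverSum G p T :=
        mul_le_mul_of_nonneg_left
          (Finset.sum_le_sum_of_subset_of_nonneg hsub
            fun W _ _ => Finset.prod_nonneg fun u _ => hp u)
          (Finset.prod_nonneg fun u _ => hp u)

lemma minCoverSum_le_one (G : SimpleGraph Vt) (p : Vt → ℝ) (hp : ∀ v, 0 ≤ p v)
    (hedge : ∀ u v, G.Adj u v → p u + p v ≤ 1) (S : Finset Vt) : minCoverSum G p S ≤ 1 := by
  induction S using Finset.strongInduction with
  | H S ih =>
  obtain rfl | ⟨v, hv⟩ := S.eq_empty_or_nonempty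
  · rw [minCoverSum, Finset.powerset_empty, Finset.sum_filter, Finset.sum_singleton]
    split_ifs <;> simp
  have hdel := ih (S.erase v) (Finset.erase_ssubset hv)
  by_cases hw : ∃ w ∈ S, G.Adj v w
  · obtain ⟨w, hwS, hvw⟩ := hw
    set N := S.filter (G.Adj v) with hN
    have hnbr := ih (S \ insert v N) (Finset.sdiff_ssubset
      (Finset.insert_subset hv (Finset.filter_subset _ _)) (Finset.insert_nonempty _ _))
    have hmem := sum_prod_le_prod_mul_minCoverSum G p hp
      ((S.powerset.filter (IsMinCoverOn G S)).filter (v ∈ ·)) {v} (S.erase v) (by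
        intro U hU
        simp only [Finset.mem_filter, Finset.mem_powerset] at hU
        obtain ⟨⟨-, hUS, hcov, hpriv⟩, hvU⟩ := hU
        refine ⟨Finset.singleton_subset_iff.2 hvU, ?_, ?_, ?_⟩ <;> grind)
    have hnmem := sum_prod_le_prod_mul_minCoverSum G p hp
      ((S.powerset.filter (IsMinCoverOn G S)).filter (v ∉ ·)) N (S \ insert v N) (by
        intro U hU
        simp only [Finset.mem_filter, Finset.mem_powerset] at hU
        obtain ⟨⟨-, hUS, hcov, hpriv⟩, hvU⟩ := hU
        have hNU : N ⊆ U := fun x hx =>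
          (hcov v hv x (Finset.mem_filter.1 hx).1 (Finset.mem_filter.1 hx).2).resolve_left hvU
        refine ⟨hNU, ?_, ?_, ?_⟩
        · grind
        · grind
        · intro u hu
          obtain ⟨huU, huN⟩ := Finset.mem_sdiff.1 hu
          obtain ⟨x, hxS, hxU, hux⟩ := hpriv u huU
          have hxv : x ≠ v := by
            rintro rfl
            exact huN (Finset.mem_filter.2 ⟨hUS huU, hux.symm⟩)
          exact ⟨x, by grind, by grind, hux⟩)
    have hsplit := Finset.sum_filter_add_sum_filter_not
      (S.powerset.filter (IsMinCoverOn G S)) (v ∈ ·) (fun U => ∏ u ∈ U, p u)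
    have hprod : ∏ u ∈ N, p u ≤ p w := by
      rw [← Finset.mul_prod_erase N p (Finset.mem_filter.2 ⟨hwS, hvw⟩)]
      refine mul_le_of_le_one_right (hp w) (Finset.prod_le_one (fun u _ => hp u) fun u hu => ?_)
      linarith [hedge v u (Finset.mem_filter.1 (Finset.mem_of_mem_erase hu)).2, hp v]
    have hprod_nonneg : 0 ≤ ∏ u ∈ N, p u := Finset.prod_nonneg fun u _ => hp u
    rw [Finset.prod_singleton] at hmem
    rw [minCoverSum, ← hsplit]
    linarith [hedge v w hvw, mul_le_of_le_one_right (hp v) hdel,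
      mul_le_of_le_one_right hprod_nonneg hnbr]
  · have hall := sum_prod_le_prod_mul_minCoverSum G p hp
      (S.powerset.filter (IsMinCoverOn G S)) ∅ (S.erase v) (by
        intro U hU
        obtain ⟨-, hUS, hcov, hpriv⟩ := Finset.mem_filter.1 hU
        have hvU : v ∉ U := fun h => by
          obtain ⟨x, hx, -, hvx⟩ := hpriv v h
          exact hw ⟨x, hx, hvx⟩
        rw [Finset.sdiff_empty]
        refine ⟨Finset.empty_subset U, ?_, ?_, ?_⟩
        · grind
        · grind
        · intro u hu
          obtain ⟨x, hx, hxU, hux⟩ := hpriv u hu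
          refine ⟨x, Finset.mem_erase.2 ⟨?_, hx⟩, hxU, hux⟩
          rintro rfl
          exact hw ⟨u, hUS hu, hux.symm⟩)
    rw [Finset.prod_empty, one_mul] at hall
    exact hall.trans hdel

lemma IsMinVertexCover.isMinCoverOn_univ [Fintype Vt] {G : SimpleGraph Vt} {U : Finset Vt}
    (h : IsMinVertexCover G (U : Set Vt)) : IsMinCoverOn G Finset.univ U := by
  refine ⟨Finset.subset_univ U, fun u _ v _ huv => h.1 u v huv, fun u hu => ?_⟩
  by_contra! hno
  have hcov : IsVertexCover G ((U : Set Vt) \ {u}) := by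
    intro a b hab
    have hadj : ∀ x, G.Adj u x → x ∈ (U : Set Vt) \ {u} := fun x hux =>
      ⟨by_contra fun hx => hno x (Finset.mem_univ x) hx hux, hux.ne'⟩
    by_cases ha : a = u
    · exact Or.inr (hadj b (ha ▸ hab))
    by_cases hb : b = u
    · exact Or.inl (hadj a (hb ▸ hab.symm))
    exact (h.1 a b hab).imp (⟨·, ha⟩) (⟨·, hb⟩)
  have hmem : u ∈ (U : Set Vt) \ {u} := by
    rw [h.2 _ Set.sdiff_subset hcov]
    exact hu
  exact hmem.2 rfl

/-- Lemma 4.10. Let `G` be a finite graph and `(p_v)` be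
nonnegative reals with `p_u + p_v ≤ 1` for every edge `{u,v}`. Then the sum,
over all minimal vertex-covers `U` of `G`, of `∏_{u ∈ U} p_u`, is at most 1. -/
theorem statement15 [Fintype Vt] (G : SimpleGraph Vt) (p : Vt → ℝ)
    (hp : ∀ v, 0 ≤ p v) (hedge : ∀ u v, G.Adj u v → p u + p v ≤ 1) :
    ∑ U ∈ Finset.univ.filter
        (fun U : Finset Vt => IsMinVertexCover G (U : Set Vt)),
      ∏ u ∈ U, p u ≤ 1 := by
  have h := sum_prod_le_prod_mul_minCoverSum G p hp
    (Finset.univ.filter fun U : Finset Vt => IsMinVertexCover G (U : Set Vt)) ∅ Finset.univ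
    fun U hU => ⟨Finset.empty_subset U, by
      rw [Finset.sdiff_empty]
      exact (Finset.mem_filter.1 hU).2.isMinCoverOn_univ⟩
  rw [Finset.prod_empty, one_mul] at h
  exact h.trans (minCoverSum_le_one G p hp hedge Finset.univ)

end AF3Potts
end
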